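/- Hölder inequality for sublinear operators: let ρ : 𝔽 → ℝ be a sublinear operator, let 1 < p, q < ∞ with 1/p + 1/q = 1, and let ξ₁, ξ₂ ∈ 𝔽 with ρ(|ξ₁|^p) > 0 and ρ(|ξ₂|^q) > 0. Then ρ(|ξ₁ξ₂|) ≤ ρ(|ξ₁|^p)^{1/p} · ρ(|ξ₂|^q)^{1/q}. -/

import Mathlib

open MeasureTheory Filter

/-- A bounded measurable real-valued function (an element of 𝔽). -/
def BddMeas {Ω : Type*} [MeasurableSpace Ω] (ξ : Ω → ℝ) : Prop :=
  Measurable ξ ∧ ∃ M : ℝ, ∀ ω, |ξ ω| ≤ M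

/-- A sublinear operator on the bounded measurable functions. -/
structure IsSublinearOp {Ω : Type*} [MeasurableSpace Ω] (ρ : (Ω → ℝ) → ℝ) : Prop where
  mono : ∀ ⦃ξ₁ ξ₂ : Ω → ℝ⦄, BddMeas ξ₁ → BddMeas ξ₂ → (∀ ω, ξ₂ ω ≤ ξ₁ ω) → ρ ξ₂ ≤ ρ ξ₁
  const : ∀ c : ℝ, ρ (fun _ => c) = c
  subadd : ∀ ⦃ξ₁ ξ₂ : Ω → ℝ⦄, BddMeas ξ₁ → BddMeas ξ₂ →
    ρ (fun ω => ξ₁ ω + ξ₂ ω) ≤ ρ ξ₁ + ρ ξ₂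
  poshom : ∀ ⦃ξ : Ω → ℝ⦄, BddMeas ξ → ∀ l : ℝ, 0 ≤ l → ρ (fun ω => l * ξ ω) = l * ρ ξ

namespace BddMeas

variable {Ω : Type*} [MeasurableSpace Ω] {ξ η : Ω → ℝ}

theorem abs_rpow (h : BddMeas ξ) {p : ℝ} (hp : 0 ≤ p) : BddMeas (fun ω => |ξ ω| ^ p) := by
  obtain ⟨hm, M, hM⟩ := h
  refine ⟨(measurable_abs.comp hm).pow_const p, M ^ p, fun ω => ?_⟩
  rw [abs_of_nonneg (Real.rpow_nonneg (abs_nonneg _) p)]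
  exact Real.rpow_le_rpow (abs_nonneg _) (hM ω) hp

theorem abs_mul (h : BddMeas ξ) (h' : BddMeas η) : BddMeas (fun ω => |ξ ω * η ω|) := by
  obtain ⟨hm, M, hM⟩ := h
  obtain ⟨hm', N, hN⟩ := h'
  refine ⟨measurable_abs.comp (hm.mul hm'), M * N, fun ω => ?_⟩
  rw [abs_abs, _root_.abs_mul]
  exact mul_le_mul (hM ω) (hN ω) (abs_nonneg _) ((abs_nonneg _).trans (hM ω))

theorem const_mul (h : BddMeas ξ) (c : ℝ) : BddMeas (fun ω => c * ξ ω) := by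
  obtain ⟨hm, M, hM⟩ := h
  refine ⟨hm.const_mul c, |c| * M, fun ω => ?_⟩
  rw [_root_.abs_mul]
  exact mul_le_mul_of_nonneg_left (hM ω) (abs_nonneg c)

theorem add (h : BddMeas ξ) (h' : BddMeas η) : BddMeas (fun ω => ξ ω + η ω) := by
  obtain ⟨hm, M, hM⟩ := h
  obtain ⟨hm', N, hN⟩ := h'
  exact ⟨hm.add hm', M + N, fun ω => (abs_add_le _ _).trans (add_le_add (hM ω) (hN ω))⟩

end BddMeas

/-- Young's inequality, rescaled by positive weights `A` and `B`. -/
theorem abs_mul_le_weighted_young {p q A B : ℝ} (h : p.HolderConjugate q) (hA : 0 < A)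
    (hB : 0 < B) (x y : ℝ) :
    |x * y| ≤ A ^ (1 / p) * B ^ (1 / q) / (p * A) * |x| ^ p
      + A ^ (1 / p) * B ^ (1 / q) / (q * B) * |y| ^ q := by
  have hp := h.pos
  have hq := h.symm.pos
  have ha : 0 < A ^ (1 / p) := Real.rpow_pos_of_pos hA _
  have hb : 0 < B ^ (1 / q) := Real.rpow_pos_of_pos hB _
  have hap : (A ^ (1 / p)) ^ p = A := by
    rw [← Real.rpow_mul hA.le, one_div_mul_cancel hp.ne', Real.rpow_one]
  have hbq : (B ^ (1 / q)) ^ q = B := by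
    rw [← Real.rpow_mul hB.le, one_div_mul_cancel hq.ne', Real.rpow_one]
  have hy := Real.young_inequality_of_nonneg (div_nonneg (abs_nonneg x) ha.le)
    (div_nonneg (abs_nonneg y) hb.le) h
  rw [Real.div_rpow (abs_nonneg x) ha.le, Real.div_rpow (abs_nonneg y) hb.le, hap, hbq] at hy
  calc |x * y|
      = A ^ (1 / p) * B ^ (1 / q) * (|x| / A ^ (1 / p) * (|y| / B ^ (1 / q))) := by
        rw [abs_mul]; field_simp
    _ ≤ A ^ (1 / p) * B ^ (1 / q) * (|x| ^ p / A / p + |y| ^ q / B / q) := by gcongr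
    _ = _ := by ring

/-- Hölder's inequality for a sublinear operator. -/
theorem stmt_12 {Ω : Type*} [MeasurableSpace Ω]
    (ρ : (Ω → ℝ) → ℝ) (hsub : IsSublinearOp ρ)
    (p q : ℝ) (hp : 1 < p) (hq : 1 < q) (hpq : 1 / p + 1 / q = 1)
    (ξ₁ ξ₂ : Ω → ℝ) (h₁ : BddMeas ξ₁) (h₂ : BddMeas ξ₂)
    (hpos₁ : 0 < ρ (fun ω => |ξ₁ ω| ^ p)) (hpos₂ : 0 < ρ (fun ω => |ξ₂ ω| ^ q)) :
    ρ (fun ω => |ξ₁ ω * ξ₂ ω|) ≤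
      (ρ (fun ω => |ξ₁ ω| ^ p)) ^ (1 / p) * (ρ (fun ω => |ξ₂ ω| ^ q)) ^ (1 / q) := by
  have h : p.HolderConjugate q :=
    Real.holderConjugate_iff.mpr ⟨hp, by simpa only [one_div] using hpq⟩
  have hp0 : 0 < p := h.pos
  have hq0 : 0 < q := h.symm.pos
  have hX := h₁.abs_rpow hp0.le
  have hY := h₂.abs_rpow hq0.le
  set A := ρ (fun ω => |ξ₁ ω| ^ p)
  set B := ρ (fun ω => |ξ₂ ω| ^ q)
  set C := A ^ (1 / p) * B ^ (1 / q)
  have hC0 : 0 ≤ C := by positivity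
  calc ρ (fun ω => |ξ₁ ω * ξ₂ ω|)
      ≤ ρ (fun ω => C / (p * A) * |ξ₁ ω| ^ p + C / (q * B) * |ξ₂ ω| ^ q) :=
        hsub.mono ((hX.const_mul _).add (hY.const_mul _)) (h₁.abs_mul h₂)
          fun ω => abs_mul_le_weighted_young h hpos₁ hpos₂ _ _
    _ ≤ ρ (fun ω => C / (p * A) * |ξ₁ ω| ^ p) + ρ (fun ω => C / (q * B) * |ξ₂ ω| ^ q) :=
        hsub.subadd (hX.const_mul _) (hY.const_mul _)
    _ = C / (p * A) * A + C / (q * B) * B := by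
        rw [hsub.poshom hX _ (by positivity), hsub.poshom hY _ (by positivity)]
    _ = C * (1 / p + 1 / q) := by
        have hA := hpos₁.ne'
        have hB := hpos₂.ne'
        clear_value C A B
        field_simp
    _ = C := by rw [hpq, mul_one]
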